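/- There exists c > 0 such that for every M ∈ {0,1}^{n×n} (n even) with rank(M) ≤ r and density p = |M|/n² satisfying 1/(8r) ≤ p ≤ 1/2, there exist X, Y ⊆ [n] with |X| = |Y| = n/2 and density of the submatrix p(M[X×Y]) ≤ p - c·p^{1/2}/√r. -/

import Mathlib

open Finset

/-- Number of 1 entries in the submatrix with rows `X` and columns `Y`. -/
noncomputable def ones {n : ℕ} (M : Matrix (Fin n) (Fin n) ℝ)
    (X Y : Finset (Fin n)) : ℝ :=
  ∑ i ∈ X, ∑ j ∈ Y, M i j

/-- Density `p = |M|/n²`. -/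
noncomputable def dens {n : ℕ} (M : Matrix (Fin n) (Fin n) ℝ) : ℝ :=
  ones M univ univ / (n * n)

theorem exists_card_eq_sum_le {ι : Type*} [Fintype ι] (a w : ι → ℝ) (m : ℕ)
    (hw0 : ∀ i, 0 ≤ w i) (hw1 : ∀ i, w i ≤ 1) (hm : ∑ i, w i = m) :
    ∃ X : Finset ι, X.card = m ∧ ∑ i ∈ X, a i ≤ ∑ i, w i * a i := by
  classical
  have hcard : m ≤ (univ : Finset ι).card := by
    have : (m : ℝ) ≤ ((univ : Finset ι).card : ℝ) := by
      rw [← hm]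
      simpa using Finset.sum_le_card_nsmul univ w 1 (fun i _ => hw1 i)
    exact_mod_cast this
  obtain ⟨X, hX, hmin⟩ := (univ.powersetCard m).exists_min_image (fun X => ∑ i ∈ X, a i)
    (powersetCard_nonempty.2 hcard)
  have hXm : X.card = m := (mem_powersetCard.1 hX).2
  refine ⟨X, hXm, ?_⟩
  have hswap : ∀ i ∈ X, ∀ j ∈ Xᶜ, a i ≤ a j := by
    intro i hi j hj
    rw [mem_compl] at hj
    have hj' : j ∉ X.erase i := fun h => hj (mem_of_mem_erase h)
    have h := hmin (insert j (X.erase i)) (by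
      rw [mem_powersetCard]
      refine ⟨subset_univ _, ?_⟩
      rw [card_insert_of_notMem hj', card_erase_add_one hi, hXm])
    simp only [sum_insert hj'] at h
    linarith [add_sum_erase X a hi]
  have hS : ∑ i ∈ X, (1 - w i) = ∑ j ∈ Xᶜ, w j := by
    have := sum_add_sum_compl X w
    rw [sum_sub_distrib, sum_const, hXm, nsmul_eq_mul, mul_one]
    linarith
  have hprod : (∑ i ∈ X, (1 - w i) * a i) * ∑ j ∈ Xᶜ, w j
      ≤ (∑ j ∈ Xᶜ, w j * a j) * ∑ i ∈ X, (1 - w i) := by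
    rw [mul_comm (∑ j ∈ Xᶜ, w j * a j), sum_mul_sum, sum_mul_sum]
    refine sum_le_sum fun i hi => sum_le_sum fun j hj => ?_
    have h1 : 0 ≤ (1 - w i) * w j := mul_nonneg (by linarith [hw1 i]) (hw0 j)
    nlinarith [mul_le_mul_of_nonneg_left (hswap i hi j hj) h1]
  have hkey : ∑ i ∈ X, (1 - w i) * a i ≤ ∑ j ∈ Xᶜ, w j * a j := by
    rw [hS] at hprod
    rcases (sum_nonneg fun j (_ : j ∈ Xᶜ) => hw0 j).eq_or_lt with h0 | hpos
    · have hz := (sum_eq_zero_iff_of_nonneg fun j (_ : j ∈ Xᶜ) => hw0 j).1 h0.symm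
      have hz' := (sum_eq_zero_iff_of_nonneg fun i (_ : i ∈ X) =>
        (by linarith [hw1 i] : 0 ≤ 1 - w i)).1 (hS.trans h0.symm)
      rw [sum_eq_zero fun i hi => by rw [hz' i hi, zero_mul],
        sum_eq_zero fun i hi => by rw [hz i hi, zero_mul]]
    · exact le_of_mul_le_mul_right hprod hpos
  have h := sum_add_sum_compl X fun i => w i * a i
  simp only [sub_mul, one_mul, sum_sub_distrib] at hkey
  linarith

theorem exists_card_eq_sum_sum_le {ι κ : Type*} [Fintype ι] [Fintype κ] (B : ι → κ → ℝ)
    (w : ι → ℝ) (z : κ → ℝ) (m : ℕ)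
    (hw0 : ∀ i, 0 ≤ w i) (hw1 : ∀ i, w i ≤ 1) (hw : ∑ i, w i = m)
    (hz0 : ∀ j, 0 ≤ z j) (hz1 : ∀ j, z j ≤ 1) (hz : ∑ j, z j = m) :
    ∃ (X : Finset ι) (Y : Finset κ), X.card = m ∧ Y.card = m ∧
      ∑ i ∈ X, ∑ j ∈ Y, B i j ≤ ∑ i, ∑ j, B i j * w i * z j := by
  obtain ⟨X, hX, hXle⟩ := exists_card_eq_sum_le (fun i => ∑ j, B i j * z j) w m hw0 hw1 hw
  obtain ⟨Y, hY, hYle⟩ := exists_card_eq_sum_le (fun j => ∑ i ∈ X, B i j) z m hz0 hz1 hz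
  refine ⟨X, Y, hX, hY, ?_⟩
  rw [sum_comm]
  refine hYle.trans (le_of_eq_of_le ?_ (hXle.trans (le_of_eq ?_)))
  · simp only [mul_sum]
    rw [sum_comm]
    exact sum_congr rfl fun i _ => sum_congr rfl fun j _ => mul_comm _ _
  · simp only [mul_sum]
    exact sum_congr rfl fun i _ => sum_congr rfl fun j _ => by ring

/-- If no `m × m` submatrix of a `2m × 2m` matrix with vanishing total has sum below `-K`, then
the bilinear form of the matrix is bounded by `32 * K` on sign vectors. -/
theorem sum_sum_mul_le_of_balanced {n m : ℕ} (hnm : n = m + m) (B : Fin n → Fin n → ℝ) (K : ℝ)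
    (hB : ∑ i, ∑ j, B i j = 0)
    (hK : ∀ X Y : Finset (Fin n), X.card = m → Y.card = m → -K ≤ ∑ i ∈ X, ∑ j ∈ Y, B i j)
    (s t : Fin n → ℝ) (hs : ∀ i, |s i| ≤ 1) (ht : ∀ j, |t j| ≤ 1) :
    ∑ i, ∑ j, B i j * s i * t j ≤ 32 * K := by
  set f : (Fin n → ℝ) → (Fin n → ℝ) → ℝ := fun s t => ∑ i, ∑ j, B i j * s i * t j with hf
  have hhalf : ∀ s t : Fin n → ℝ, (∀ i, |s i| ≤ 1) → (∀ j, |t j| ≤ 1) → ∑ i, s i = 0 →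
      ∑ j, t j = 0 → -(4 * K) ≤ f s (fun _ => 1) + f (fun _ => 1) t + f s t := by
    intro s t hs ht hs0 ht0
    have hw : ∀ s : Fin n → ℝ, ∑ i, s i = 0 → ∑ i, (1 + s i) / 2 = (m : ℝ) := by
      intro s hs0
      rw [← sum_div, sum_add_distrib, hs0]
      simp [hnm]
    obtain ⟨X, Y, hX, hY, h⟩ := exists_card_eq_sum_sum_le B (fun i => (1 + s i) / 2)
      (fun j => (1 + t j) / 2) m
      (fun i => by linarith [(abs_le.1 (hs i)).1]) (fun i => by linarith [(abs_le.1 (hs i)).2])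
      (hw s hs0)
      (fun i => by linarith [(abs_le.1 (ht i)).1]) (fun i => by linarith [(abs_le.1 (ht i)).2])
      (hw t ht0)
    have h2 := (hK X Y hX hY).trans h
    have h3 : ∑ i, ∑ j, B i j * ((1 + s i) / 2) * ((1 + t j) / 2)
        = ((∑ i, ∑ j, B i j) + (f s (fun _ => 1) + f (fun _ => 1) t + f s t)) / 4 := by
      simp only [hf, ← sum_add_distrib, sum_div]
      exact sum_congr rfl fun i _ => sum_congr rfl fun j _ => by ring
    rw [h3, hB] at h2
    linarith
  have hzero : ∀ s, f s 0 = 0 ∧ f 0 s = 0 := by intro s; simp [hf]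
  have hneg : ∀ s t, f (-s) t = -f s t ∧ f s (-t) = -f s t := by
    intro s t
    simp only [hf, Pi.neg_apply, ← sum_neg_distrib]
    exact ⟨sum_congr rfl fun i _ => sum_congr rfl fun j _ => by ring,
      sum_congr rfl fun i _ => sum_congr rfl fun j _ => by ring⟩
  set c : (Fin n → ℝ) → Fin n → ℝ := fun s i => (s i - (∑ k, s k) / n) / 2 with hc
  rcases Nat.eq_zero_or_pos n with hn | hn
  · subst hn
    have := hK ∅ ∅ (by simp; omega) (by simp; omega)
    simp at this ⊢
    linarith
  have hn' : (0 : ℝ) < n := by exact_mod_cast hn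
  have hmean : ∀ s : Fin n → ℝ, (∀ i, |s i| ≤ 1) → |(∑ k, s k) / n| ≤ 1 := by
    intro s hs
    rw [abs_div, abs_of_pos hn', div_le_one hn']
    refine (abs_sum_le_sum_abs _ _).trans ((sum_le_sum fun i _ => hs i).trans (by simp))
  have hc1 : ∀ s : Fin n → ℝ, (∀ i, |s i| ≤ 1) → ∀ i, |c s i| ≤ 1 := by
    intro s hs i
    simp only [hc]
    rw [abs_div, abs_two, div_le_one two_pos]
    refine (abs_sub _ _).trans ?_
    linarith [hs i, hmean s hs]
  have hc0 : ∀ s, ∑ i, c s i = 0 := by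
    intro s
    simp only [hc, ← sum_div, sum_sub_distrib, sum_const, card_univ, Fintype.card_fin, nsmul_eq_mul]
    field_simp
    simp
  have hcneg : ∀ s : Fin n → ℝ, (∀ i, |s i| ≤ 1) → (∀ i, |(-c s) i| ≤ 1) ∧ ∑ i, (-c s) i = 0 := by
    intro s hs
    refine ⟨fun i => by rw [Pi.neg_apply, abs_neg]; exact hc1 s hs i, ?_⟩
    simp only [Pi.neg_apply, sum_neg_distrib, hc0, neg_zero]
  have h1 : f (fun _ => 1) (fun _ => 1) = 0 := by simpa [hf] using hB
  have hexp : f s t = 4 * f (c s) (c t) + (∑ k, t k) / n * (2 * f (c s) (fun _ => 1))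
      + (∑ k, s k) / n * (2 * f (fun _ => 1) (c t))
      + (∑ k, s k) / n * ((∑ k, t k) / n) * f (fun _ => 1) (fun _ => 1) := by
    simp only [hf, hc, mul_sum, ← sum_add_distrib]
    exact sum_congr rfl fun i _ => sum_congr rfl fun j _ => by ring
  have hz1 : ∀ i : Fin n, |(0 : Fin n → ℝ) i| ≤ 1 := fun i => by simp
  have hz0 : ∑ i : Fin n, (0 : Fin n → ℝ) i = 0 := by simp
  obtain ⟨hs1, hs2⟩ := hcneg s hs
  obtain ⟨ht1, ht2⟩ := hcneg t ht
  have hb : ∀ a b : ℝ, |a| ≤ 1 → |b| ≤ 4 * K → a * (2 * b) ≤ 8 * K := by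
    intro a b ha hb
    refine (le_abs_self _).trans ?_
    rw [abs_mul, abs_mul, abs_two]
    nlinarith [abs_nonneg a, abs_nonneg b]
  have hA : |f (c s) (fun _ => 1)| ≤ 4 * K := by
    have e1 := hhalf (c s) 0 (hc1 s hs) hz1 (hc0 s) hz0
    have e2 := hhalf (-c s) 0 hs1 hz1 hs2 hz0
    rw [(hzero _).1, (hzero _).1] at e1 e2
    rw [(hneg _ _).1] at e2
    exact abs_le.2 ⟨by linarith, by linarith⟩
  have hA' : |f (fun _ => 1) (c t)| ≤ 4 * K := by
    have e1 := hhalf 0 (c t) hz1 (hc1 t ht) hz0 (hc0 t)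
    have e2 := hhalf 0 (-c t) hz1 ht1 hz0 ht2
    rw [(hzero _).2, (hzero _).2] at e1 e2
    rw [(hneg _ _).2] at e2
    exact abs_le.2 ⟨by linarith, by linarith⟩
  have hC : f (c s) (c t) ≤ 4 * K := by
    have e1 := hhalf (-c s) (c t) hs1 (hc1 t ht) hs2 (hc0 t)
    have e2 := hhalf (c s) (-c t) (hc1 s hs) ht1 (hc0 s) ht2
    simp only [(hneg _ _).1, (hneg _ _).2] at e1 e2
    linarith
  have := hb _ _ (hmean t ht) hA
  have := hb _ _ (hmean s hs) hA'
  change f s t ≤ 32 * K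
  rw [hexp, h1]
  linarith

/-- Orthonormal functions on a finite sample space whose linear combinations satisfy the fourth
moment bound of Rademacher sums. -/
theorem exists_rademacher {α : Type*} (s : Finset α) :
    ∃ (Ω : Type) (_ : Fintype Ω) (_ : Nonempty Ω) (φ : α → Ω → ℝ),
      (∀ a b : α → ℝ, ∑ ω, (∑ i ∈ s, a i * φ i ω) * (∑ i ∈ s, b i * φ i ω)
        = Fintype.card Ω * ∑ i ∈ s, a i * b i) ∧
      ∀ a : α → ℝ, ∑ ω, (∑ i ∈ s, a i * φ i ω) ^ 4
        ≤ Fintype.card Ω * (3 * (∑ i ∈ s, a i ^ 2) ^ 2) := by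
  classical
  induction s using Finset.induction_on with
  | empty => exact ⟨Unit, inferInstance, inferInstance, fun _ _ => 0, by simp, by simp⟩
  | insert i₀ s hi ih =>
    obtain ⟨Ω, _, _, φ, h2, h4⟩ := ih
    refine ⟨Ω × Bool, inferInstance, inferInstance,
      fun i ω => if i = i₀ then (if ω.2 then 1 else -1) else φ i ω.1, ?_, ?_⟩
    all_goals
      have hsum : ∀ (a : α → ℝ) (e : Bool) (ω : Ω),
          ∑ i ∈ s, a i * (if i = i₀ then (if e then 1 else -1) else φ i ω)
            = ∑ i ∈ s, a i * φ i ω := by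
        intro a e ω
        refine sum_congr rfl fun i his => ?_
        rw [if_neg fun h : i = i₀ => hi (h ▸ his)]
    · intro a b
      simp only [sum_insert hi, Fintype.sum_prod_type, Fintype.sum_bool, hsum, if_true,
        Bool.false_eq_true, if_false, Fintype.card_prod, Fintype.card_bool]
      have : ∀ ω, (a i₀ * 1 + ∑ i ∈ s, a i * φ i ω) * (b i₀ * 1 + ∑ i ∈ s, b i * φ i ω)
          + (a i₀ * -1 + ∑ i ∈ s, a i * φ i ω) * (b i₀ * -1 + ∑ i ∈ s, b i * φ i ω)
          = 2 * (a i₀ * b i₀) + 2 * ((∑ i ∈ s, a i * φ i ω) * ∑ i ∈ s, b i * φ i ω) :=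
        fun ω => by ring
      simp only [this, sum_add_distrib, ← mul_sum, h2, sum_const, card_univ, nsmul_eq_mul]
      push_cast
      ring
    · intro a
      simp only [sum_insert hi, Fintype.sum_prod_type, Fintype.sum_bool, hsum, if_true,
        Bool.false_eq_true, if_false, Fintype.card_prod, Fintype.card_bool]
      have : ∀ ω, (a i₀ * 1 + ∑ i ∈ s, a i * φ i ω) ^ 4 + (a i₀ * -1 + ∑ i ∈ s, a i * φ i ω) ^ 4
          = 2 * a i₀ ^ 4 + 12 * a i₀ ^ 2 * ((∑ i ∈ s, a i * φ i ω) * ∑ i ∈ s, a i * φ i ω)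
            + 2 * (∑ i ∈ s, a i * φ i ω) ^ 4 :=
        fun ω => by ring
      simp only [this, sum_add_distrib, ← mul_sum, h2, sum_const, card_univ, nsmul_eq_mul]
      have h := h4 a
      have hsq : ∑ i ∈ s, a i * a i = ∑ i ∈ s, a i ^ 2 := by simp only [sq]
      rw [hsq]
      have hp : 0 ≤ (Fintype.card Ω : ℝ) * a i₀ ^ 4 := by positivity
      push_cast
      nlinarith

theorem abs_sub_clip_le (x : ℝ) : |x - max (-2) (min 2 x)| ≤ x ^ 2 / 8 := by
  rcases le_total x 2 with h | h
  · rw [min_eq_right h]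
    rcases le_total (-2) x with h' | h'
    · rw [max_eq_right h', sub_self, abs_zero]; positivity
    · rw [max_eq_left h', abs_le]
      constructor <;> nlinarith [sq_nonneg (x + 4)]
  · rw [min_eq_left h, max_eq_right (by norm_num), abs_le]
    constructor <;> nlinarith [sq_nonneg (x - 4)]

theorem abs_clip_le_abs (x : ℝ) : |max (-2) (min 2 x)| ≤ |x| := by
  rcases le_total x 2 with h | h
  · rw [min_eq_right h]
    rcases le_total (-2) x with h' | h'
    · rw [max_eq_right h']
    · rw [max_eq_left h', abs_of_nonpos (by norm_num), abs_of_nonpos (by linarith)]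
      linarith
  · rw [min_eq_left h, max_eq_right (by norm_num), abs_two]
    exact h.trans (le_abs_self x)

theorem abs_clip_le_two (x : ℝ) : |max (-2) (min 2 x)| ≤ 2 :=
  abs_le.2 ⟨le_max_left _ _, max_le (by norm_num) (min_le_left _ _)⟩

/-- `G` bounds the bilinear form of `B` over all finite-dimensional unit vectors. -/
def IsVectorBound {ι κ : Type*} [Fintype ι] [Fintype κ] (B : ι → κ → ℝ) (G : ℝ) : Prop :=
  ∀ (Ω : Type) [Fintype Ω] (x : ι → Ω → ℝ) (y : κ → Ω → ℝ),
    (∀ i, ∑ ω, x i ω ^ 2 ≤ 1) → (∀ j, ∑ ω, y j ω ^ 2 ≤ 1) →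
      ∑ i, ∑ j, B i j * ∑ ω, x i ω * y j ω ≤ G

section Grothendieck

variable {ι κ : Type*} [Fintype ι] [Fintype κ] {B : ι → κ → ℝ} {G N : ℝ}

theorem isVectorBound_sum_abs (B : ι → κ → ℝ) : IsVectorBound B (∑ i, ∑ j, |B i j|) := by
  intro Ω _ x y hx hy
  refine sum_le_sum fun i _ => sum_le_sum fun j _ => ?_
  have h : |∑ ω, x i ω * y j ω| ≤ 1 := by
    refine abs_le_one_iff_mul_self_le_one.2 ?_
    rw [← sq]
    refine (sum_mul_sq_le_sq_mul_sq univ (x i) (y j)).trans ?_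
    exact mul_le_one₀ (hx i) (sum_nonneg fun _ _ => sq_nonneg _) (hy j)
  refine (le_abs_self _).trans ?_
  rw [abs_mul]
  exact mul_le_of_le_one_right (abs_nonneg _) h

theorem IsVectorBound.le_of_sq_le (hG : IsVectorBound B G) {Ω : Type} [Fintype Ω] {a b : ℝ}
    (ha : 0 < a) (hb : 0 < b) (x : ι → Ω → ℝ) (y : κ → Ω → ℝ)
    (hx : ∀ i, ∑ ω, x i ω ^ 2 ≤ a ^ 2) (hy : ∀ j, ∑ ω, y j ω ^ 2 ≤ b ^ 2) :
    ∑ i, ∑ j, B i j * ∑ ω, x i ω * y j ω ≤ a * b * G := by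
  have h := hG Ω (fun i ω => x i ω / a) (fun j ω => y j ω / b)
    (fun i => by
      simp only [div_pow, ← sum_div]
      exact (div_le_one (by positivity)).2 (hx i))
    (fun j => by
      simp only [div_pow, ← sum_div]
      exact (div_le_one (by positivity)).2 (hy j))
  have e : ∑ i, ∑ j, B i j * ∑ ω, x i ω / a * (y j ω / b)
      = (∑ i, ∑ j, B i j * ∑ ω, x i ω * y j ω) / (a * b) := by
    simp only [sum_div, mul_sum]
    refine sum_congr rfl fun i _ => sum_congr rfl fun j _ => sum_congr rfl fun ω _ => ?_
    field_simp
  rw [e, div_le_iff₀ (by positivity)] at h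
  linarith

theorem IsVectorBound.improve (hG : IsVectorBound B G)
    (hN : ∀ (s : ι → ℝ) (t : κ → ℝ), (∀ i, |s i| ≤ 1) → (∀ j, |t j| ≤ 1) →
      ∑ i, ∑ j, B i j * s i * t j ≤ N) :
    IsVectorBound B (4 * N + G / 2) := by
  intro α _ x y hx hy
  obtain ⟨Ω, _, _, φ, h2, h4⟩ := exists_rademacher (univ : Finset α)
  set n : ℝ := (Fintype.card Ω : ℝ) with hn
  have hn0 : 0 < n := by rw [hn]; exact_mod_cast Fintype.card_pos
  set T : (α → ℝ) → Ω → ℝ := fun a ω => ∑ i, a i * φ i ω with hT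
  set C : (α → ℝ) → Ω → ℝ := fun a ω => max (-2) (min 2 (T a ω)) with hC
  have hTsq : ∀ a : α → ℝ, ∑ i, a i ^ 2 ≤ 1 → ∑ ω, T a ω ^ 2 ≤ (√n) ^ 2 := by
    intro a ha
    have := h2 a a
    simp only [← sq] at this
    rw [Real.sq_sqrt hn0.le, this]
    nlinarith
  have hCsq : ∀ a : α → ℝ, ∑ i, a i ^ 2 ≤ 1 → ∑ ω, C a ω ^ 2 ≤ (√n) ^ 2 := fun a ha =>
    (sum_le_sum fun ω _ => sq_le_sq.2 (abs_clip_le_abs _)).trans (hTsq a ha)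
  have hRsq : ∀ a : α → ℝ, ∑ i, a i ^ 2 ≤ 1 →
      ∑ ω, (T a ω - C a ω) ^ 2 ≤ (√n / 4) ^ 2 := by
    intro a ha
    have h1 : ∑ ω, (T a ω - C a ω) ^ 2 ≤ ∑ ω, T a ω ^ 4 / 64 := by
      refine sum_le_sum fun ω _ => ?_
      have := sq_le_sq' (by linarith [abs_nonneg (T a ω - C a ω), sq_nonneg (T a ω)])
        (abs_sub_clip_le (T a ω))
      rw [sq_abs] at this
      refine this.trans (le_of_eq (by ring))
    rw [← sum_div] at h1
    have h3 : (∑ i, a i ^ 2) ^ 2 ≤ 1 := pow_le_one₀ (sum_nonneg fun _ _ => sq_nonneg _) ha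
    have := h4 a
    rw [div_pow, Real.sq_sqrt hn0.le]
    nlinarith
  have hs : 0 < √n := Real.sqrt_pos.2 hn0
  have b1 := hG.le_of_sq_le (by positivity) hs _ _ (fun i => hRsq (x i) (hx i))
    (fun j => hTsq (y j) (hy j))
  have b2 := hG.le_of_sq_le hs (by positivity) _ _ (fun i => hCsq (x i) (hx i))
    (fun j => hRsq (y j) (hy j))
  have b3 : ∑ i, ∑ j, B i j * ∑ ω, C (x i) ω * C (y j) ω ≤ n * (4 * N) := by
    have e : ∑ i, ∑ j, B i j * ∑ ω, C (x i) ω * C (y j) ω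
        = ∑ ω, 4 * ∑ i, ∑ j, B i j * (C (x i) ω / 2) * (C (y j) ω / 2) := by
      simp only [mul_sum]
      rw [sum_comm' (t' := univ) (s' := fun _ => univ) (by simp)]
      rw [sum_comm]
      conv_rhs => rw [sum_comm]
      refine sum_congr rfl fun i _ => ?_
      conv_rhs => rw [sum_comm]
      refine sum_congr rfl fun j _ => sum_congr rfl fun ω _ => by ring
    rw [e]
    have hh : ∀ z : ℝ, |max (-2) (min 2 z) / 2| ≤ 1 := fun z => by
      rw [abs_div, abs_two, div_le_one two_pos]; exact abs_clip_le_two z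
    refine (sum_le_sum fun ω _ => mul_le_mul_of_nonneg_left
      (hN (fun i => C (x i) ω / 2) (fun j => C (y j) ω / 2) (fun i => hh _) (fun j => hh _))
      (by norm_num)).trans (le_of_eq ?_)
    rw [sum_const, card_univ, nsmul_eq_mul]
  have e : n * ∑ i, ∑ j, B i j * ∑ k, x i k * y j k
      = (∑ i, ∑ j, B i j * ∑ ω, (T (x i) ω - C (x i) ω) * T (y j) ω)
        + (∑ i, ∑ j, B i j * ∑ ω, C (x i) ω * (T (y j) ω - C (y j) ω))
        + ∑ i, ∑ j, B i j * ∑ ω, C (x i) ω * C (y j) ω := by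
    simp_rw [mul_sum univ _ n]
    simp only [← sum_add_distrib, ← mul_add]
    refine sum_congr rfl fun i _ => sum_congr rfl fun j _ => ?_
    rw [mul_left_comm, ← h2]
    congr 1
    exact sum_congr rfl fun ω _ => by simp only [hT]; ring
  have hss : √n * √n = n := Real.mul_self_sqrt hn0.le
  have : n * ∑ i, ∑ j, B i j * ∑ k, x i k * y j k ≤ n * (4 * N + G / 2) := by
    rw [e]
    have e1 : √n / 4 * √n * G = n * G / 4 := by linear_combination G / 4 * hss
    have e2 : √n * (√n / 4) * G = n * G / 4 := by linear_combination G / 4 * hss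
    linarith
  exact le_of_mul_le_mul_left this hn0

/-- **Grothendieck's inequality** with constant `8`. -/
theorem isVectorBound_of_sign_bound
    (hN : ∀ (s : ι → ℝ) (t : κ → ℝ), (∀ i, |s i| ≤ 1) → (∀ j, |t j| ≤ 1) →
      ∑ i, ∑ j, B i j * s i * t j ≤ N) :
    IsVectorBound B (8 * N) := by
  set S := ∑ i, ∑ j, |B i j|
  have hk : ∀ k : ℕ, IsVectorBound B (8 * N + (S - 8 * N) * (1 / 2) ^ k) := by
    intro k
    induction k with
    | zero => simpa using isVectorBound_sum_abs B
    | succ k ih =>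
      have := ih.improve hN
      convert this using 1
      ring
  intro Ω _ x y hx hy
  refine ge_of_tendsto' (f := fun k : ℕ => 8 * N + (S - 8 * N) * (1 / 2) ^ k)
    (x := Filter.atTop) ?_ fun k => hk k Ω x y hx hy
  have := (tendsto_pow_atTop_nhds_zero_of_lt_one (r := (1 / 2 : ℝ)) (by norm_num)
    (by norm_num)).const_mul (S - 8 * N) |>.const_add (8 * N)
  simpa using this

end Grothendieck

theorem sum_sq_pow_three_le {ι : Type*} [Fintype ι] (σ : ι → ℝ) (hσ : ∀ i, 0 ≤ σ i) (R : ℕ)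
    (hR : (univ.filter fun i => σ i ≠ 0).card ≤ R) :
    (∑ i, σ i ^ 2) ^ 3 ≤ R * (∑ i, σ i ^ 3) ^ 2 := by
  set F := ∑ i, σ i ^ 2
  set T := ∑ i, σ i ^ 3
  set S := ∑ i, σ i
  have hF0 : 0 ≤ F := sum_nonneg fun i _ => sq_nonneg _
  have hT0 : 0 ≤ T := sum_nonneg fun i _ => pow_nonneg (hσ i) 3
  have hS0 : 0 ≤ S := sum_nonneg fun i _ => hσ i
  have h1 : F ^ 2 ≤ S * T := sum_sq_le_sum_mul_sum_of_sq_le_mul univ (fun i _ => hσ i)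
    (fun i _ => pow_nonneg (hσ i) 3) (fun i _ => by ring_nf; rfl)
  have h2 : S ^ 2 ≤ R * F := by
    have hS : S = ∑ i ∈ univ.filter (fun i => σ i ≠ 0), σ i := (sum_filter_ne_zero univ).symm
    rw [hS]
    refine sq_sum_le_card_mul_sum_sq.trans ?_
    exact mul_le_mul (by exact_mod_cast hR)
      (sum_le_sum_of_subset_of_nonneg (filter_subset _ _) fun i _ _ => sq_nonneg _)
      (sum_nonneg fun i _ => sq_nonneg _) (by positivity)
  rcases hF0.eq_or_lt with h | h
  · rw [← h, zero_pow three_ne_zero]; positivity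
  · refine le_of_mul_le_mul_left ?_ h
    have h3 : (F ^ 2) ^ 2 ≤ (S * T) ^ 2 := pow_le_pow_left₀ (sq_nonneg _) h1 2
    nlinarith [mul_le_mul_of_nonneg_right h2 (sq_nonneg T)]

open Matrix in
/-- Vector systems read off from the spectral decomposition of `Bᵀ * B`, correlated with `B` by
the sum of the cubes of its singular values. -/
theorem exists_vectors_of_rank_le {n : ℕ} (B : Matrix (Fin n) (Fin n) ℝ) (R : ℕ)
    (hR : B.rank ≤ R) :
    ∃ x y : Fin n → Fin n → ℝ,
      (∀ i, ∑ k, x i k ^ 2 = ∑ j, B i j ^ 2) ∧ (∀ j, ∑ k, y j k ^ 2 = ∑ i, B i j ^ 2) ∧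
      0 ≤ ∑ i, ∑ j, B i j * ∑ k, x i k * y j k ∧
      (∑ i, ∑ j, B i j ^ 2) ^ 3 ≤ R * (∑ i, ∑ j, B i j * ∑ k, x i k * y j k) ^ 2 := by
  have hA : (Bᵀ * B).IsHermitian := isHermitian_conjTranspose_mul_self B
  have hpsd : (Bᵀ * B).PosSemidef := posSemidef_conjTranspose_mul_self B
  set l := hA.eigenvalues with hl
  have hl0 : ∀ i, 0 ≤ l i := hpsd.eigenvalues_nonneg
  set σ : Fin n → ℝ := fun i => √(l i) with hσ
  set U : Matrix (Fin n) (Fin n) ℝ := hA.eigenvectorUnitary.1 with hU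
  have hUU : U * Uᵀ = 1 := Unitary.coe_mul_star_self hA.eigenvectorUnitary
  have hUU' : Uᵀ * U = 1 := Unitary.coe_star_mul_self hA.eigenvectorUnitary
  have hspec : Bᵀ * B = U * diagonal l * Uᵀ := hA.spectral_theorem
  have hdd : diagonal σ * diagonal σ = diagonal l := by
    rw [diagonal_mul_diagonal]
    congr 1
    funext i
    exact Real.mul_self_sqrt (hl0 i)
  have hXX : (B * U) * (B * U)ᵀ = B * Bᵀ := by
    rw [transpose_mul, Matrix.mul_assoc, ← Matrix.mul_assoc U, hUU, Matrix.one_mul]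
  have hYY : (U * diagonal σ) * (U * diagonal σ)ᵀ = Bᵀ * B := by
    rw [hspec, ← hdd, transpose_mul, diagonal_transpose]
    simp only [Matrix.mul_assoc]
  have hcorr : ∑ i, ∑ j, B i j * ∑ k, (B * U) i k * (U * diagonal σ) j k = ∑ i, σ i ^ 3 := by
    have e : ∑ i, ∑ j, B i j * ∑ k, (B * U) i k * (U * diagonal σ) j k
        = trace (B * (U * diagonal σ * (B * U)ᵀ)) := by
      simp only [trace, Matrix.diag, mul_apply (M := B) (N := U * diagonal σ * (B * U)ᵀ)]
      refine sum_congr rfl fun i _ => sum_congr rfl fun j _ => ?_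
      rw [mul_apply (M := U * diagonal σ)]
      congr 1
      exact sum_congr rfl fun k _ => mul_comm _ _
    have e2 : trace (B * (U * diagonal σ * (B * U)ᵀ)) = trace (diagonal l * diagonal σ) := by
      rw [transpose_mul, trace_mul_comm]
      have : U * diagonal σ * (Uᵀ * Bᵀ) * B = U * (diagonal σ * ((Uᵀ * U) * diagonal l * Uᵀ)) := by
        simp only [Matrix.mul_assoc]
        rw [hspec]
        simp only [Matrix.mul_assoc]
      rw [this, hUU', Matrix.one_mul, trace_mul_comm]
      simp only [Matrix.mul_assoc, hUU', Matrix.mul_one]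
      rw [trace_mul_comm]
    rw [e, e2, diagonal_mul_diagonal, trace_diagonal]
    refine sum_congr rfl fun i _ => ?_
    rw [← Real.mul_self_sqrt (hl0 i)]
    simp only [hσ]
    ring
  have hF : ∑ i, ∑ j, B i j ^ 2 = ∑ i, σ i ^ 2 := by
    have e : ∑ i, ∑ j, B i j ^ 2 = trace (Bᵀ * B) := by
      simp only [trace, Matrix.diag, mul_apply, transpose_apply, sq]
      exact sum_comm
    rw [e, hspec, trace_mul_comm, ← Matrix.mul_assoc, hUU', Matrix.one_mul, trace_diagonal]
    exact sum_congr rfl fun i _ => (Real.sq_sqrt (hl0 i)).symm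
  refine ⟨B * U, U * diagonal σ, fun i => ?_, fun j => ?_, ?_, ?_⟩
  · have := congrFun (congrFun hXX i) i
    simpa only [mul_apply (M := B * U), mul_apply (M := B) (N := Bᵀ), transpose_apply, ← sq]
      using this
  · have := congrFun (congrFun hYY j) j
    simpa only [mul_apply (M := U * diagonal σ), mul_apply (M := Bᵀ), transpose_apply, ← sq]
      using this
  · rw [hcorr]
    exact sum_nonneg fun i _ => pow_nonneg (Real.sqrt_nonneg _) 3
  · rw [hcorr, hF]
    refine sum_sq_pow_three_le σ (fun i => Real.sqrt_nonneg _) R ?_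
    have h1 := hA.rank_eq_card_non_zero_eigs
    rw [rank_transpose_mul_self, Fintype.card_subtype] at h1
    refine le_trans (le_of_eq ?_) (h1.symm.trans_le hR)
    congr 1
    ext i
    simp only [mem_filter, mem_univ, true_and]
    exact not_congr (Real.sqrt_eq_zero (hl0 i))

theorem rank_add_le_rank_add_rank {n : ℕ} (A B : Matrix (Fin n) (Fin n) ℝ) :
    (A + B).rank ≤ A.rank + B.rank := by
  unfold Matrix.rank
  rw [Matrix.mulVecLin_add]
  exact (Submodule.finrank_mono (LinearMap.range_add_le _ _)).trans
    (Submodule.finrank_add_le_finrank_add_finrank _ _)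

theorem sum_abs_row_sum_le {ι κ : Type*} [Fintype ι] [Fintype κ] {B : ι → κ → ℝ} {N : ℝ}
    (hN : ∀ (s : ι → ℝ) (t : κ → ℝ), (∀ i, |s i| ≤ 1) → (∀ j, |t j| ≤ 1) →
      ∑ i, ∑ j, B i j * s i * t j ≤ N) :
    ∑ i, |∑ j, B i j| ≤ N := by
  refine le_of_eq_of_le ?_ (hN (fun i => if 0 ≤ ∑ j, B i j then 1 else -1) (fun _ => 1)
    (fun i => by split_ifs <;> simp) (fun _ => by simp))
  refine sum_congr rfl fun i _ => ?_
  simp only [mul_one, ← sum_mul]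
  split_ifs with h
  · rw [abs_of_nonneg h, mul_one]
  · rw [abs_of_neg (not_le.1 h), mul_neg_one]

/-- The rows of sum more than twice the average carry little of the total. -/
theorem sum_heavy_rows_le {ι κ : Type*} [Fintype ι] [Fintype κ] (M : ι → κ → ℝ) (p N : ℝ)
    (hN : ∑ i, |∑ j, (M i j - p)| ≤ N) :
    ∑ i, (1 - if ∑ j, M i j ≤ 2 * (p * Fintype.card κ) then (1 : ℝ) else 0) * ∑ j, M i j
      ≤ 2 * N := by
  refine le_trans ?_ (mul_le_mul_of_nonneg_left hN two_pos.le)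
  rw [mul_sum]
  refine sum_le_sum fun i _ => ?_
  split_ifs with h
  · rw [sub_self, zero_mul]; positivity
  · have h1 : ∑ j, (M i j - p) = ∑ j, M i j - p * Fintype.card κ := by
      rw [sum_sub_distrib, sum_const, card_univ, nsmul_eq_mul, mul_comm p]
    have := le_abs_self (∑ j, (M i j - p))
    rw [h1] at this ⊢
    linarith

theorem sum_light_row_sq_le {ι κ : Type*} [Fintype κ] (M : ι → κ → ℝ)
    (hM : ∀ i j, M i j = 0 ∨ M i j = 1) (p : ℝ) (hp0 : 0 ≤ p) (hp1 : p ≤ 1) (h : κ → ℝ)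
    (hh : ∀ j, h j = 0 ∨ h j = 1) (i : ι) :
    ∑ j, ((if ∑ j, M i j ≤ 2 * (p * Fintype.card κ) then (1 : ℝ) else 0) * (M i j - p) * h j) ^ 2
      ≤ 3 * (p * Fintype.card κ) := by
  split_ifs with hi
  · have : ∀ j, (1 * (M i j - p) * h j) ^ 2 ≤ M i j + p ^ 2 := by
      intro j
      rcases hM i j with h0 | h0 <;> rcases hh j with h1 | h1 <;> rw [h0, h1] <;>
        nlinarith [sq_nonneg p]
    refine (sum_le_sum fun j _ => this j).trans ?_
    rw [sum_add_distrib, sum_const, card_univ, nsmul_eq_mul]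
    have hc : (0 : ℝ) ≤ Fintype.card κ := Nat.cast_nonneg _
    nlinarith [mul_le_mul_of_nonneg_left hp1 (mul_nonneg hc hp0)]
  · simp only [zero_mul, zero_pow two_ne_zero, sum_const_zero]
    positivity

/-- A lower bound for the bilinear form of a centred `0`-`1` matrix of low rank on sign vectors. -/
theorem pow_three_le_of_sign_bound {n r : ℕ} (M : Matrix (Fin n) (Fin n) ℝ)
    (hM : ∀ i j, M i j = 0 ∨ M i j = 1) (hr : M.rank ≤ r) (p : ℝ) (hp0 : 0 < p)
    (hp : p ≤ 1 / 2) (hn : 0 < n) (hsum : ∑ i, ∑ j, M i j = p * n ^ 2) (N : ℝ)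
    (hN : ∀ s t : Fin n → ℝ, (∀ i, |s i| ≤ 1) → (∀ j, |t j| ≤ 1) →
      ∑ i, ∑ j, (M i j - p) * s i * t j ≤ N)
    (hNle : 4 * N ≤ p * n ^ 2 / 2) :
    (p * n ^ 2 / 8) ^ 3 ≤ (r + 1) * (24 * (p * n) * N) ^ 2 := by
  have hn0 : (0 : ℝ) < n := by exact_mod_cast hn
  have hM0 : ∀ i j, 0 ≤ M i j := fun i j => by rcases hM i j with h | h <;> rw [h]; norm_num
  set g : Fin n → ℝ := fun i => if ∑ j, M i j ≤ 2 * (p * Fintype.card (Fin n)) then 1 else 0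
    with hg
  set h : Fin n → ℝ := fun j => if ∑ i, M i j ≤ 2 * (p * Fintype.card (Fin n)) then 1 else 0
    with hh
  have hg01 : ∀ i, g i = 0 ∨ g i = 1 := fun i => by simp only [hg]; split_ifs <;> simp
  have hh01 : ∀ j, h j = 0 ∨ h j = 1 := fun j => by simp only [hh]; split_ifs <;> simp
  have hrows : ∑ i, (1 - g i) * ∑ j, M i j ≤ 2 * N :=
    sum_heavy_rows_le (fun i j => M i j) p N (sum_abs_row_sum_le hN)
  have hcols : ∑ j, (1 - h j) * ∑ i, M i j ≤ 2 * N := by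
    refine sum_heavy_rows_le (fun j i => M i j) p N (sum_abs_row_sum_le fun s t hs ht => ?_)
    rw [sum_comm]
    refine le_of_eq_of_le ?_ (hN t s ht hs)
    exact sum_congr rfl fun i _ => sum_congr rfl fun j _ => by ring
  set B : Matrix (Fin n) (Fin n) ℝ := fun i j => g i * (M i j - p) * h j with hB
  have hmass : p * n ^ 2 - 4 * N ≤ ∑ i, ∑ j, g i * M i j * h j := by
    have e : ∑ i, ∑ j, M i j - ∑ i, (1 - g i) * ∑ j, M i j - ∑ j, (1 - h j) * ∑ i, M i j
        ≤ ∑ i, ∑ j, g i * M i j * h j := by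
      simp only [mul_sum]
      rw [sum_comm (f := fun j i => (1 - h j) * M i j)]
      simp only [← sum_sub_distrib]
      refine sum_le_sum fun i _ => sum_le_sum fun j _ => ?_
      rcases hg01 i with h1 | h1 <;> rcases hh01 j with h2 | h2 <;> rw [h1, h2] <;>
        linarith [hM0 i j]
    linarith
  have hF : p * n ^ 2 / 8 ≤ ∑ i, ∑ j, B i j ^ 2 := by
    have e : (∑ i, ∑ j, g i * M i j * h j) / 4 ≤ ∑ i, ∑ j, B i j ^ 2 := by
      simp only [sum_div]
      refine sum_le_sum fun i _ => sum_le_sum fun j _ => ?_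
      simp only [hB]
      rcases hg01 i with h1 | h1 <;> rcases hh01 j with h2 | h2 <;> rcases hM i j with h3 | h3 <;>
        rw [h1, h2, h3] <;> nlinarith
    linarith
  have hrank : B.rank ≤ r + 1 := by
    have e : B = Matrix.diagonal g * M * Matrix.diagonal h
        + Matrix.vecMulVec (fun i => -p * g i) h := by
      ext i j
      simp only [hB, Matrix.add_apply, Matrix.mul_diagonal, Matrix.diagonal_mul,
        Matrix.vecMulVec_apply]
      ring
    rw [e]
    refine (rank_add_le_rank_add_rank _ _).trans
      (add_le_add ?_ (Matrix.rank_vecMulVec_le _ _))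
    exact (Matrix.rank_mul_le_left _ _).trans ((Matrix.rank_mul_le_right _ _).trans hr)
  have hBN : ∀ s t : Fin n → ℝ, (∀ i, |s i| ≤ 1) → (∀ j, |t j| ≤ 1) →
      ∑ i, ∑ j, B i j * s i * t j ≤ N := by
    intro s t hs ht
    refine le_of_eq_of_le ?_ (hN (fun i => g i * s i) (fun j => h j * t j) (fun i => ?_)
      fun j => ?_)
    · exact sum_congr rfl fun i _ => sum_congr rfl fun j _ => by simp only [hB]; ring
    · rcases hg01 i with h1 | h1 <;> simp [h1, hs i]
    · rcases hh01 j with h1 | h1 <;> simp [h1, ht j]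
  obtain ⟨x, y, hx, hy, hT0, hT⟩ := exists_vectors_of_rank_le B (r + 1) hrank
  have hsq : √(3 * (p * n)) ^ 2 = 3 * (p * n) := Real.sq_sqrt (by positivity)
  have hpos : 0 < √(3 * (p * n)) := Real.sqrt_pos.2 (by positivity)
  have hTle := (isVectorBound_of_sign_bound hBN).le_of_sq_le hpos hpos x y
    (fun i => by
      rw [hx, hsq]
      have := sum_light_row_sq_le (fun i j => M i j) hM p hp0.le (by linarith) h hh01 i
      rw [Fintype.card_fin] at this
      simpa only [hB, hg, Fintype.card_fin] using this)
    (fun j => by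
      rw [hy, hsq]
      have := sum_light_row_sq_le (fun j i => M i j) (fun j i => hM i j) p hp0.le (by linarith)
        g hg01 j
      rw [Fintype.card_fin] at this
      refine le_of_eq_of_le (sum_congr rfl fun i _ => ?_) this
      simp only [hB, hh, Fintype.card_fin]
      ring)
  rw [← sq, hsq] at hTle
  calc (p * n ^ 2 / 8) ^ 3 ≤ (∑ i, ∑ j, B i j ^ 2) ^ 3 := pow_le_pow_left₀ (by positivity) hF 3
    _ ≤ _ := hT
    _ ≤ (r + 1) * (24 * (p * n) * N) ^ 2 := by
      push_cast
      refine mul_le_mul_of_nonneg_left (pow_le_pow_left₀ hT0 (hTle.trans (le_of_eq ?_)) 2)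
        (by positivity)
      ring

theorem stmt10 :
    ∃ c : ℝ, 0 < c ∧
      ∀ (n r : ℕ), Even n → 0 < r →
      ∀ M : Matrix (Fin n) (Fin n) ℝ,
        (∀ i j, M i j = 0 ∨ M i j = 1) →
        M.rank ≤ r →
        1 / (8 * r) ≤ dens M → dens M ≤ 1 / 2 →
        ∃ X Y : Finset (Fin n),
          X.card = n / 2 ∧ Y.card = n / 2 ∧
          ones M X Y / (X.card * Y.card) ≤
            dens M - c * Real.sqrt (dens M) / Real.sqrt r := by
  refine ⟨1 / 10000, by norm_num, ?_⟩
  intro n r hne hr M hM hrank hp1 hp2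
  by_contra! hcon
  have hr0 : (0 : ℝ) < r := by exact_mod_cast hr
  have hr1 : (1 : ℝ) ≤ r := by exact_mod_cast hr
  have hp0 : 0 < dens M := lt_of_lt_of_le (by positivity) hp1
  have hn : 0 < n := by
    rcases Nat.eq_zero_or_pos n with h | h
    · subst h
      simp [_root_.dens] at hp0
    · exact h
  have hn0 : (0 : ℝ) < n := by exact_mod_cast hn
  obtain ⟨m, hm⟩ := hne
  have hm2 : n / 2 = m := by omega
  have hm0 : (0 : ℝ) < m := by exact_mod_cast (by omega : 0 < m)
  have hnm : (n : ℝ) = 2 * m := by rw [hm]; push_cast; ring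
  have hsum : ∑ i, ∑ j, M i j = dens M * n ^ 2 := by
    simp only [_root_.dens, ones]
    field_simp
  set p := dens M
  set δ := √p / √r with hδ
  have hδ0 : 0 ≤ δ := by positivity
  have hδsq : r * δ ^ 2 = p := by
    rw [hδ, div_pow, Real.sq_sqrt hp0.le, Real.sq_sqrt hr0.le]
    field_simp
  have hδp : δ ≤ 3 * p := by
    rw [div_le_iff₀ (by positivity)] at hp1
    refine (sq_le_sq₀ hδ0 (by positivity)).1 ?_
    refine le_of_mul_le_mul_left ?_ hr0
    rw [hδsq]
    nlinarith
  have hN := sum_sum_mul_le_of_balanced hm (fun i j => M i j - p) (1 / 10000 * δ * m ^ 2)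
    (by
      simp only [sum_sub_distrib, hsum, sum_const, card_univ, Fintype.card_fin, nsmul_eq_mul]
      ring)
    (by
      intro X Y hX hY
      have := hcon X Y (by rw [hX, hm2]) (by rw [hY, hm2])
      rw [hX, hY, lt_div_iff₀ (by positivity), mul_div_assoc] at this
      simp only [sum_sub_distrib, sum_const, hX, hY, nsmul_eq_mul]
      simp only [ones] at this
      nlinarith)
  have key := pow_three_le_of_sign_bound M hM hrank p hp0 hp2 hn hsum _ hN (by
    rw [hnm]
    nlinarith [mul_le_mul_of_nonneg_right hδp (sq_nonneg (m : ℝ))])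
  rw [hnm] at key
  have e1 : (p * (2 * m) ^ 2 / 8) ^ 3 = p ^ 3 * m ^ 6 / 8 := by ring
  have e2 : (24 * (p * (2 * m)) * (32 * (1 / 10000 * δ * m ^ 2))) ^ 2
      = (1536 / 10000) ^ 2 * (δ ^ 2 * (p ^ 2 * m ^ 6)) := by ring
  rw [e1, e2] at key
  have hP : 0 < p ^ 3 * (m : ℝ) ^ 6 := by positivity
  have h1 : (r + 1) * δ ^ 2 ≤ 2 * p := by nlinarith [sq_nonneg δ]
  have h2 := mul_le_mul_of_nonneg_right h1 (by positivity : 0 ≤ p ^ 2 * (m : ℝ) ^ 6)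
  nlinarith
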